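/- In the positive braid monoid B_n^+, every nontrivial element has a nontrivial head: for every g in B_n^+ with g ≠ 1, the greatest common left-divisor of g and Δ_n exists and is not equal to 1. -/

import Mathlib

/-- In a monoid, `a` left-divides `b` if `b = a * c` for some `c`. -/
def LeftDvd {M : Type*} [Monoid M] (a b : M) : Prop := ∃ c, b = a * c

/-- `d` is a greatest common left-divisor of `a` and `b`: it is a common left-divisor
of `a` and `b` which is left-divided by every common left-divisor of `a` and `b`. -/
def IsGCLD {M : Type*} [Monoid M] (a b d : M) : Prop :=
  LeftDvd d a ∧ LeftDvd d b ∧ ∀ e, LeftDvd e a → LeftDvd e b → LeftDvd e d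

/-- The braid relations on the free monoid over `Fin (n - 1)`: the index `i : Fin (n - 1)`
stands for the Artin generator `σ_{i+1}` (indices are 0-based), and the relations are
`σ_i σ_j σ_i = σ_j σ_i σ_j` for `|i - j| = 1` and `σ_i σ_j = σ_j σ_i` for `|i - j| ≥ 2`. -/
def braidRels (n : ℕ) : FreeMonoid (Fin (n - 1)) → FreeMonoid (Fin (n - 1)) → Prop :=
  fun x y =>
    (∃ i j : Fin (n - 1), (i : ℕ) + 1 = (j : ℕ) ∧
        x = .of i * .of j * .of i ∧ y = .of j * .of i * .of j) ∨
    (∃ i j : Fin (n - 1), (i : ℕ) + 2 ≤ (j : ℕ) ∧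
        x = .of i * .of j ∧ y = .of j * .of i)

/-- The positive braid monoid `B_n⁺`, presented by the generators `σ_1, …, σ_{n-1}`
and the braid relations. -/
def BraidMonoid (n : ℕ) := PresentedMonoid (braidRels n)

instance (n : ℕ) : Monoid (BraidMonoid n) :=
  inferInstanceAs (Monoid (PresentedMonoid (braidRels n)))

/-- The generator `σ_{i+1}` of `B_n⁺` (0-based index `i : Fin (n - 1)`). -/
def σ {n : ℕ} (i : Fin (n - 1)) : BraidMonoid n := PresentedMonoid.of (braidRels n) i

/-- `desc n k = σ_k σ_{k-1} ⋯ σ_1` (1-based indices; `desc n 0 = 1`). -/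
def desc (n : ℕ) : ℕ → BraidMonoid n
  | 0 => 1
  | k + 1 => (if h : k < n - 1 then σ ⟨k, h⟩ else 1) * desc n k

/-- `deltaAux n m` is Garside's fundamental element `Δ_m` computed inside `B_n⁺`:
`Δ_1 = 1` and `Δ_{m+1} = Δ_m ⬝ (σ_m σ_{m-1} ⋯ σ_1)`. -/
def deltaAux (n : ℕ) : ℕ → BraidMonoid n
  | 0 => 1
  | m + 1 => deltaAux n m * desc n m

/-- Garside's fundamental element `Δ_n` of the positive braid monoid `B_n⁺`. -/
def Δ (n : ℕ) : BraidMonoid n := deltaAux n n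

/-! ### Generators and word length -/

namespace BraidMonoid

variable {n : ℕ}

/-- The generators `σ_i` and `σ_j` do not commute: their indices are consecutive. -/
def Adj (i j : Fin (n - 1)) : Prop := (i : ℕ) + 1 = j ∨ (j : ℕ) + 1 = i

theorem Adj.symm {i j : Fin (n - 1)} (h : Adj i j) : Adj j i := Or.symm h

theorem Adj.ne {i j : Fin (n - 1)} (h : Adj i j) : i ≠ j := by
  rintro rfl
  unfold Adj at h
  omega

theorem not_adj_of_adj_of_adj {i j k : Fin (n - 1)} (h : Adj k i) (h' : Adj k j) :
    ¬ Adj i j := by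
  unfold Adj at *
  omega

/-- The class of a word in the braid monoid. -/
def ofWord : FreeMonoid (Fin (n - 1)) →* BraidMonoid n := PresentedMonoid.mk (braidRels n)

theorem ofWord_of (i : Fin (n - 1)) : ofWord (.of i) = σ i := rfl

theorem ofWord_surjective : Function.Surjective (ofWord (n := n)) :=
  Con.mk'_surjective

theorem ofWord_eq_iff {x y : FreeMonoid (Fin (n - 1))} :
    ofWord x = ofWord y ↔ ConGen.Rel (braidRels n) x y :=
  Con.eq _

theorem braid_of_succ {i j : Fin (n - 1)} (h : (i : ℕ) + 1 = j) :
    (σ i * σ j * σ i : BraidMonoid n) = σ j * σ i * σ j :=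
  ofWord_eq_iff.2 (.of _ _ (.inl ⟨i, j, h, rfl, rfl⟩))

theorem comm_of_le {i j : Fin (n - 1)} (h : (i : ℕ) + 2 ≤ j) :
    (σ i * σ j : BraidMonoid n) = σ j * σ i :=
  ofWord_eq_iff.2 (.of _ _ (.inr ⟨i, j, h, rfl, rfl⟩))

theorem Adj.braid {i j : Fin (n - 1)} (h : Adj i j) (x : BraidMonoid n) :
    σ i * (σ j * (σ i * x)) = σ j * (σ i * (σ j * x)) := by
  have : (σ i * σ j * σ i : BraidMonoid n) = σ j * σ i * σ j :=
    h.elim braid_of_succ fun h => (braid_of_succ h).symm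
  simp only [← mul_assoc, this]

theorem comm_of_not_adj {i j : Fin (n - 1)} (h : ¬ Adj i j) (x : BraidMonoid n) :
    σ i * (σ j * x) = σ j * (σ i * x) := by
  have : (σ i * σ j : BraidMonoid n) = σ j * σ i := by
    unfold Adj at h
    rcases eq_or_ne i j with rfl | hij
    · rfl
    · have := Fin.val_ne_of_ne hij
      rcases le_total (i : ℕ) j with h' | h'
      · exact comm_of_le (by omega)
      · exact (comm_of_le (by omega)).symm
  simp only [← mul_assoc, this]

/-- Word length, as a homomorphism. -/
def lengthHom (n : ℕ) : BraidMonoid n →* Multiplicative ℕ :=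
  PresentedMonoid.lift (fun _ => Multiplicative.ofAdd 1) (by
    rintro _ _ (⟨i, j, -, rfl, rfl⟩ | ⟨i, j, -, rfl, rfl⟩) <;> simp)

/-- The length of a positive braid. -/
def len (x : BraidMonoid n) : ℕ := (lengthHom n x).toAdd

theorem len_mul (x y : BraidMonoid n) : len (x * y) = len x + len y := by
  simp [len]

theorem len_one : len (1 : BraidMonoid n) = 0 := by
  simp [len]

theorem len_σ (i : Fin (n - 1)) : len (σ i : BraidMonoid n) = 1 := rfl

theorem eq_one_or_exists_σ_mul (x : BraidMonoid n) : x = 1 ∨ ∃ i y, x = σ i * y := by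
  obtain ⟨w, rfl⟩ := ofWord_surjective x
  induction w using FreeMonoid.casesOn with
  | one => exact .inl (map_one _)
  | of_mul i w => exact .inr ⟨i, ofWord w, by rw [map_mul, ofWord_of]⟩

theorem eq_one_of_len_eq_zero {x : BraidMonoid n} (h : len x = 0) : x = 1 := by
  refine (eq_one_or_exists_σ_mul x).resolve_right ?_
  rintro ⟨i, y, rfl⟩
  rw [len_mul, len_σ] at h
  omega

/-! ### Garside's lemma on common multiples of two generators -/

open Classical in
/-- The complement of `σ_i` in the least common right-multiple of `σ_i` and `σ_j`. -/
noncomputable def compl (i j : Fin (n - 1)) : BraidMonoid n :=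
  if i = j then 1 else if Adj i j then σ j * σ i else σ j

theorem compl_self (i : Fin (n - 1)) : (compl i i : BraidMonoid n) = 1 := if_pos rfl

theorem compl_of_adj {i j : Fin (n - 1)} (h : Adj i j) :
    (compl i j : BraidMonoid n) = σ j * σ i := by
  simp [compl, h, h.ne]

theorem compl_of_not_adj {i j : Fin (n - 1)} (hne : i ≠ j) (h : ¬ Adj i j) :
    (compl i j : BraidMonoid n) = σ j := by
  simp [compl, h, hne]

theorem σ_mul_compl (i j : Fin (n - 1)) :
    (σ i * compl i j : BraidMonoid n) = σ j * compl j i := by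
  rcases eq_or_ne i j with rfl | hne
  · rfl
  by_cases h : Adj i j
  · simpa [compl_of_adj h, compl_of_adj h.symm] using h.braid 1
  · simpa [compl_of_not_adj hne h, compl_of_not_adj hne.symm (mt Adj.symm h)]
      using comm_of_not_adj h 1

/-- The elements `a` and `b` are the remainders of a common right-multiple of the least common
right-multiple of `σ_i` and `σ_j`. -/
def Match (i j : Fin (n - 1)) (a b : BraidMonoid n) : Prop :=
  ∃ c, a = compl i j * c ∧ b = compl j i * c

theorem match_self {i : Fin (n - 1)} {a b : BraidMonoid n} : Match i i a b ↔ a = b := by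
  simp [Match, compl_self, eq_comm]

theorem match_of_adj {i j : Fin (n - 1)} (h : Adj i j) {a b : BraidMonoid n} :
    Match i j a b ↔ ∃ c, a = σ j * (σ i * c) ∧ b = σ i * (σ j * c) := by
  simp [Match, compl_of_adj h, compl_of_adj h.symm, mul_assoc]

theorem match_of_not_adj {i j : Fin (n - 1)} (hne : i ≠ j) (h : ¬ Adj i j)
    {a b : BraidMonoid n} : Match i j a b ↔ ∃ c, a = σ j * c ∧ b = σ i * c := by
  simp [Match, compl_of_not_adj hne h, compl_of_not_adj hne.symm (mt Adj.symm h)]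

theorem Match.symm {i j : Fin (n - 1)} {a b : BraidMonoid n} (h : Match i j a b) :
    Match j i b a :=
  let ⟨c, ha, hb⟩ := h
  ⟨c, hb, ha⟩

theorem Match.mul_right {i j : Fin (n - 1)} {a b : BraidMonoid n} (h : Match i j a b)
    (x : BraidMonoid n) : Match i j (a * x) (b * x) := by
  obtain ⟨c, rfl, rfl⟩ := h
  exact ⟨c * x, mul_assoc .., mul_assoc ..⟩

/-- Garside's lemma for remainders of length less than `N`. -/
def MatchBelow (n N : ℕ) : Prop :=
  ∀ (i j : Fin (n - 1)) (a b : BraidMonoid n), len a < N → σ i * a = σ j * b → Match i j a b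

theorem MatchBelow.cancel {N : ℕ} (H : MatchBelow n N) {i : Fin (n - 1)} {a b : BraidMonoid n}
    (ha : len a < N) (h : σ i * a = σ i * b) : a = b :=
  match_self.1 (H i i a b ha h)

theorem MatchBelow.adj {N : ℕ} (H : MatchBelow n N) {i j : Fin (n - 1)} (hij : Adj i j)
    {a b : BraidMonoid n} (ha : len a < N) (h : σ i * a = σ j * b) :
    ∃ c, a = σ j * (σ i * c) ∧ b = σ i * (σ j * c) :=
  (match_of_adj hij).1 (H i j a b ha h)

theorem MatchBelow.not_adj {N : ℕ} (H : MatchBelow n N) {i j : Fin (n - 1)} (hne : i ≠ j)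
    (hij : ¬ Adj i j) {a b : BraidMonoid n} (ha : len a < N) (h : σ i * a = σ j * b) :
    ∃ c, a = σ j * c ∧ b = σ i * c :=
  (match_of_not_adj hne hij).1 (H i j a b ha h)

/-- The transitivity step when `σ_k` braids with `σ_i` and commutes with `σ_j`. -/
theorem MatchBelow.trans_of_adj_of_not_adj {N : ℕ} (H : MatchBelow n N) {i j k : Fin (n - 1)}
    (hij : i ≠ j) (hkj : k ≠ j) (aki : Adj k i) (akj : ¬ Adj k j) {a m b : BraidMonoid n}
    (hm : len m ≤ N) (h₁ : Match i k a m) (h₂ : Match k j m b) : Match i j a b := by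
  obtain ⟨c, rfl, rfl⟩ := (match_of_adj aki.symm).1 h₁
  obtain ⟨c', hc, rfl⟩ := (match_of_not_adj hkj akj).1 h₂
  simp only [len_mul, len_σ] at hm
  by_cases aij : Adj i j
  · obtain ⟨d, hd, rfl⟩ := H.adj aij (by simp only [len_mul, len_σ]; omega) hc
    obtain ⟨e, rfl, he⟩ := H.not_adj hkj akj (by omega) hd
    have hl := congrArg len he
    have hl' := congrArg len hd
    simp only [len_mul, len_σ] at hl hl' hm
    obtain ⟨f, rfl, rfl⟩ := H.adj aki.symm (by omega) he
    refine (match_of_adj aij).2 ⟨σ k * (σ i * (σ j * f)), ?_, ?_⟩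
    · rw [aij.braid, comm_of_not_adj akj, ← comm_of_not_adj akj f, aki.braid]
    · rw [← comm_of_not_adj akj (σ i * f), aki.braid, aij.braid, comm_of_not_adj akj]
  · obtain ⟨d, hd, rfl⟩ := H.not_adj hij aij (by simp only [len_mul, len_σ]; omega) hc
    obtain ⟨e, rfl, rfl⟩ := H.not_adj hkj akj (by omega) hd
    refine (match_of_not_adj hij aij).2 ⟨σ k * (σ i * e), ?_, ?_⟩
    · rw [comm_of_not_adj aij, comm_of_not_adj akj]
    · rw [aki.braid]

theorem MatchBelow.trans {N : ℕ} (H : MatchBelow n N) {i j k : Fin (n - 1)}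
    {a m b : BraidMonoid n} (hm : len m ≤ N) (h₁ : Match i k a m) (h₂ : Match k j m b) :
    Match i j a b := by
  rcases eq_or_ne k i with rfl | hki
  · rwa [match_self.1 h₁]
  rcases eq_or_ne k j with rfl | hkj
  · rwa [← match_self.1 h₂]
  by_cases aki : Adj k i <;> by_cases akj : Adj k j
  · obtain ⟨c, rfl, rfl⟩ := (match_of_adj aki.symm).1 h₁
    obtain ⟨c', hc, rfl⟩ := (match_of_adj akj).1 h₂
    have hl := congrArg len hc
    simp only [len_mul, len_σ] at hm hl
    rcases eq_or_ne i j with rfl | hij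
    · have h := H.cancel (by simp only [len_mul, len_σ]; omega) hc
      rw [match_self, H.cancel (by omega) h]
    have aij := not_adj_of_adj_of_adj aki akj
    obtain ⟨d, hd, hd'⟩ := H.not_adj hij aij (by simp only [len_mul, len_σ]; omega) hc
    obtain ⟨e, rfl, rfl⟩ := H.adj akj (by omega) hd
    obtain ⟨f, rfl, hf⟩ := H.adj aki (by omega) hd'
    have hl' := congrArg len hf
    simp only [len_mul, len_σ] at hm hl'
    have h := H.cancel (by simp only [len_mul, len_σ]; omega) hf
    obtain ⟨g, rfl, rfl⟩ := H.not_adj (Ne.symm hij) (mt Adj.symm aij) (by omega) h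
    refine (match_of_not_adj hij aij).2 ⟨σ k * (σ j * (σ i * (σ k * g))), ?_, ?_⟩
    · rw [comm_of_not_adj aij, aki.symm.braid, akj.braid]
    · rw [← comm_of_not_adj aij (σ k * (σ j * g)), akj.symm.braid, aki.braid,
        comm_of_not_adj aij]
  · rcases eq_or_ne i j with rfl | hij
    · exact absurd aki akj
    exact H.trans_of_adj_of_not_adj hij hkj aki akj hm h₁ h₂
  · rcases eq_or_ne i j with rfl | hij
    · exact absurd akj aki
    exact (H.trans_of_adj_of_not_adj hij.symm hki akj aki hm h₂.symm h₁.symm).symm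
  · obtain ⟨c, rfl, rfl⟩ := (match_of_not_adj hki.symm (mt Adj.symm aki)).1 h₁
    obtain ⟨c', hc, rfl⟩ := (match_of_not_adj hkj akj).1 h₂
    simp only [len_mul, len_σ] at hm
    rcases eq_or_ne i j with rfl | hij
    · rw [match_self, H.cancel (by omega) hc]
    by_cases aij : Adj i j
    · obtain ⟨d, rfl, rfl⟩ := H.adj aij (by omega) hc
      refine (match_of_adj aij).2 ⟨σ k * d, ?_, ?_⟩
      · rw [comm_of_not_adj akj, comm_of_not_adj aki]
      · rw [comm_of_not_adj aki, comm_of_not_adj akj]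
    · obtain ⟨d, rfl, rfl⟩ := H.not_adj hij aij (by omega) hc
      exact (match_of_not_adj hij aij).2
        ⟨σ k * d, comm_of_not_adj akj d, comm_of_not_adj aki d⟩

theorem match_of_rel {N : ℕ} (H : MatchBelow n N) {x y : FreeMonoid (Fin (n - 1))}
    (h : ConGen.Rel (braidRels n) x y) :
    ∀ i j u v, x = .of i * u → y = .of j * v → len (ofWord u) ≤ N →
      Match i j (ofWord u) (ofWord v) := by
  have of_mul_inj {i j : Fin (n - 1)} {u v : FreeMonoid (Fin (n - 1))}
      (h : FreeMonoid.of i * u = FreeMonoid.of j * v) : i = j ∧ u = v :=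
    List.cons.inj h
  have not_rel_one {z : FreeMonoid (Fin (n - 1))} {i : Fin (n - 1)}
      {u : FreeMonoid (Fin (n - 1))} (h : ofWord z = ofWord (.of i * u)) : z ≠ 1 := by
    rintro rfl
    have := congrArg len h
    simp only [map_one, map_mul, len_one, len_mul, ofWord_of, len_σ] at this
    omega
  induction h with
  | of x y h =>
    rintro i j u v hx hy -
    rcases h with ⟨i', j', h, rfl, rfl⟩ | ⟨i', j', h, rfl, rfl⟩
    · rw [mul_assoc] at hx hy
      obtain ⟨rfl, rfl⟩ := of_mul_inj hx
      obtain ⟨rfl, rfl⟩ := of_mul_inj hy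
      exact (match_of_adj (.inl h)).2 ⟨1, by simp [ofWord_of], by simp [ofWord_of]⟩
    · obtain ⟨rfl, rfl⟩ := of_mul_inj hx
      obtain ⟨rfl, rfl⟩ := of_mul_inj hy
      refine (match_of_not_adj ?_ ?_).2 ⟨1, by simp [ofWord_of], by simp [ofWord_of]⟩
      · rintro rfl
        omega
      · unfold Adj
        omega
  | refl x =>
    rintro i j u v rfl h -
    obtain ⟨rfl, rfl⟩ := of_mul_inj h
    exact match_self.2 rfl
  | symm h ih =>
    rintro i j u v rfl rfl hu
    refine (ih j i v u rfl rfl ?_).symm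
    have := congrArg len (ofWord_eq_iff.2 h)
    simp only [map_mul, len_mul, ofWord_of, len_σ] at this
    omega
  | @trans x y z h h' ih ih' =>
    rintro i j u v rfl rfl hu
    induction y using FreeMonoid.casesOn with
    | one => exact absurd rfl (not_rel_one (ofWord_eq_iff.2 h).symm)
    | of_mul k w =>
      have := congrArg len (ofWord_eq_iff.2 h)
      simp only [map_mul, len_mul, ofWord_of, len_σ] at this
      exact H.trans (by omega) (ih i k u w rfl rfl hu) (ih' k j w v rfl rfl (by omega))
  | @mul w y x z h h' ih ih' =>
    intro i j u v hu hv hN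
    induction w using FreeMonoid.casesOn with
    | one =>
      induction y using FreeMonoid.casesOn with
      | one => exact ih' i j u v (by simpa using hu) (by simpa using hv) hN
      | of_mul k t => exact absurd rfl (not_rel_one (ofWord_eq_iff.2 h))
    | of_mul k t =>
      induction y using FreeMonoid.casesOn with
      | one => exact absurd rfl (not_rel_one (ofWord_eq_iff.2 h).symm)
      | of_mul l s =>
        rw [mul_assoc] at hu hv
        obtain ⟨rfl, rfl⟩ := of_mul_inj hu
        obtain ⟨rfl, rfl⟩ := of_mul_inj hv
        rw [map_mul, len_mul] at hN
        rw [map_mul, map_mul, ofWord_eq_iff.2 h']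
        exact (ih _ _ t s rfl rfl (by omega)).mul_right _

theorem matchBelow (n N : ℕ) : MatchBelow n N := by
  induction N with
  | zero => exact fun _ _ _ _ h => absurd h (Nat.not_lt_zero _)
  | succ N H =>
    intro i j a b ha h
    obtain ⟨u, rfl⟩ := ofWord_surjective a
    obtain ⟨v, rfl⟩ := ofWord_surjective b
    rw [← ofWord_of, ← ofWord_of, ← map_mul, ← map_mul] at h
    exact match_of_rel H (ofWord_eq_iff.1 h) i j u v rfl rfl (Nat.le_of_lt_succ ha)

/-- **Garside's lemma**: a common right-multiple of two generators is a right-multiple of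
their least common right-multiple. -/
theorem match_of_σ_mul_eq {i j : Fin (n - 1)} {a b : BraidMonoid n} (h : σ i * a = σ j * b) :
    Match i j a b :=
  matchBelow n _ i j a b (Nat.lt_succ_self _) h

theorem mul_left_cancel' {a b : BraidMonoid n} (x : BraidMonoid n) (h : x * a = x * b) :
    a = b := by
  obtain ⟨w, rfl⟩ := ofWord_surjective x
  induction w using FreeMonoid.inductionOn' with
  | one => simpa using h
  | of_mul i w ih =>
    rw [map_mul, ofWord_of, mul_assoc, mul_assoc] at h
    exact ih (match_self.1 (match_of_σ_mul_eq h))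

/-! ### Least common multiples and greatest common divisors -/

theorem leftDvd_one_left (x : BraidMonoid n) : LeftDvd 1 x := ⟨x, (one_mul x).symm⟩

theorem leftDvd_refl (x : BraidMonoid n) : LeftDvd x x := ⟨1, (mul_one x).symm⟩

theorem leftDvd_trans {x y z : BraidMonoid n} (h : LeftDvd x y) (h' : LeftDvd y z) :
    LeftDvd x z := by
  obtain ⟨a, rfl⟩ := h
  obtain ⟨b, rfl⟩ := h'
  exact ⟨a * b, mul_assoc ..⟩

theorem mul_leftDvd_mul_left_iff (x : BraidMonoid n) {y z : BraidMonoid n} :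
    LeftDvd (x * y) (x * z) ↔ LeftDvd y z := by
  constructor
  · rintro ⟨c, hc⟩
    exact ⟨c, mul_left_cancel' x (by rw [hc, mul_assoc])⟩
  · rintro ⟨c, rfl⟩
    exact ⟨c, (mul_assoc ..).symm⟩

/-- Two left-divisors of a positive braid have a least common right-multiple. -/
theorem exists_lcm (g u v : BraidMonoid n) (hu : LeftDvd u g) (hv : LeftDvd v g) :
    ∃ l, LeftDvd u l ∧ LeftDvd v l ∧ ∀ h, LeftDvd u h → LeftDvd v h → LeftDvd l h := by
  induction hN : len g using Nat.strong_induction_on generalizing g u v with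
  | h N ih =>
    subst hN
    rcases eq_one_or_exists_σ_mul u with rfl | ⟨i, u, rfl⟩
    · exact ⟨v, leftDvd_one_left v, leftDvd_refl v, fun _ _ h => h⟩
    rcases eq_one_or_exists_σ_mul v with rfl | ⟨j, v, rfl⟩
    · exact ⟨σ i * u, leftDvd_refl _, leftDvd_one_left _, fun _ h _ => h⟩
    have key (h : BraidMonoid n) (hu : LeftDvd (σ i * u) h) (hv : LeftDvd (σ j * v) h) :
        ∃ c, h = σ i * (compl i j * c) ∧ LeftDvd u (compl i j * c) ∧
          LeftDvd v (compl j i * c) := by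
      obtain ⟨p, rfl⟩ := hu
      obtain ⟨q, hq⟩ := hv
      rw [mul_assoc, mul_assoc] at hq
      obtain ⟨c, hc, hc'⟩ := match_of_σ_mul_eq hq
      exact ⟨c, by rw [mul_assoc, hc], ⟨p, hc.symm⟩, ⟨q, hc'.symm⟩⟩
    obtain ⟨c, rfl, huc, hvc⟩ := key g hu hv
    have hlen := congrArg len (σ_mul_compl (n := n) i j)
    simp only [len_mul, len_σ] at hlen ih
    obtain ⟨_, hul, ⟨x, rfl⟩, hx⟩ :=
      ih _ (by omega) _ u (compl i j) huc ⟨c, rfl⟩ (len_mul _ _)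
    obtain ⟨_, hvl, ⟨y, rfl⟩, hy⟩ :=
      ih _ (by omega) _ v (compl j i) hvc ⟨c, rfl⟩ (len_mul _ _)
    have hxc {c} (h : LeftDvd u (compl i j * c)) : LeftDvd x c :=
      (mul_leftDvd_mul_left_iff _).1 (hx _ h ⟨c, rfl⟩)
    have hyc {c} (h : LeftDvd v (compl j i * c)) : LeftDvd y c :=
      (mul_leftDvd_mul_left_iff _).1 (hy _ h ⟨c, rfl⟩)
    obtain ⟨z, hxz, hyz, hz⟩ := ih _ (by omega) c x y (hxc huc) (hyc hvc) rfl
    refine ⟨σ i * (compl i j * z), ?_, ?_, ?_⟩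
    · exact (mul_leftDvd_mul_left_iff _).2
        (leftDvd_trans hul ((mul_leftDvd_mul_left_iff _).2 hxz))
    · rw [← mul_assoc, σ_mul_compl, mul_assoc]
      exact (mul_leftDvd_mul_left_iff _).2
        (leftDvd_trans hvl ((mul_leftDvd_mul_left_iff _).2 hyz))
    · intro h hu hv
      obtain ⟨c, rfl, huc, hvc⟩ := key h hu hv
      rw [mul_leftDvd_mul_left_iff, mul_leftDvd_mul_left_iff]
      exact hz c (hxc huc) (hyc hvc)

theorem exists_isGCLD (a b : BraidMonoid n) : ∃ d, IsGCLD a b d := by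
  let S : Set ℕ := {m | ∃ d, LeftDvd d a ∧ LeftDvd d b ∧ len d = m}
  have hS : BddAbove S := by
    refine ⟨len a, ?_⟩
    rintro _ ⟨d, ⟨c, rfl⟩, -, rfl⟩
    rw [len_mul]
    exact Nat.le_add_right _ _
  obtain ⟨d, hda, hdb, hd⟩ : sSup S ∈ S :=
    Nat.sSup_mem ⟨_, 1, leftDvd_one_left a, leftDvd_one_left b, rfl⟩ hS
  refine ⟨d, hda, hdb, fun e hea heb => ?_⟩
  obtain ⟨_, ⟨c, rfl⟩, hel, hl⟩ := exists_lcm a d e hda hea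
  have hle := le_csSup hS ⟨d * c, hl a hda hea, hl b hdb heb, rfl⟩
  rw [← hd, len_mul] at hle
  rwa [eq_one_of_len_eq_zero (x := c) (by omega), mul_one] at hel

/-! ### Every generator left-divides the fundamental element -/

/-- The generator of index `k`, or `1` when `k` is out of range. -/
def gen (n k : ℕ) : BraidMonoid n := if h : k < n - 1 then σ ⟨k, h⟩ else 1

theorem desc_succ (k : ℕ) : desc n (k + 1) = gen n k * desc n k := rfl

theorem gen_comm {k l : ℕ} (h : k + 2 ≤ l) : Commute (gen n l) (gen n k) := by
  unfold gen
  split_ifs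
  · exact (comm_of_le h).symm
  all_goals simp

theorem gen_braid {k : ℕ} (h : k + 1 < n - 1) :
    gen n k * gen n (k + 1) * gen n k = gen n (k + 1) * gen n k * gen n (k + 1) := by
  simp only [gen, h, (Nat.lt_succ_self k).trans h, dite_true]
  exact braid_of_succ rfl

theorem gen_comm_desc {k l : ℕ} (h : k + 1 ≤ l) : Commute (gen n l) (desc n k) := by
  induction k with
  | zero => exact Commute.one_right _
  | succ k ih => exact (gen_comm h).mul_right (ih (by omega))

theorem gen_comm_deltaAux {m l : ℕ} (h : m ≤ l) : Commute (gen n l) (deltaAux n m) := by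
  induction m with
  | zero => exact Commute.one_right _
  | succ m ih => exact (ih (by omega)).mul_right (gen_comm_desc h)

theorem gen_mul_desc {k m : ℕ} (h : k + 2 ≤ m) (hm : m ≤ n - 1) :
    gen n k * desc n m = desc n m * gen n (k + 1) := by
  induction m, h using Nat.le_induction with
  | base =>
    rw [desc_succ, desc_succ, ← mul_assoc, ← mul_assoc, gen_braid (by omega), mul_assoc,
      (gen_comm_desc le_rfl).eq]
    simp only [mul_assoc]
  | succ m h ih =>
    rw [desc_succ, ← mul_assoc, ← (gen_comm h).eq, mul_assoc, ih (by omega), mul_assoc]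

theorem exists_desc_mul_desc {k m : ℕ} (h : k + 1 ≤ m) (hm : m ≤ n - 1) :
    ∃ x, desc n k * desc n m = desc n m * x := by
  induction k with
  | zero => exact ⟨1, (one_mul _).trans (mul_one _).symm⟩
  | succ k ih =>
    obtain ⟨x, hx⟩ := ih (by omega)
    exact ⟨gen n (k + 1) * x, by
      rw [desc_succ, mul_assoc, hx, ← mul_assoc, gen_mul_desc h hm, mul_assoc]⟩

theorem gen_leftDvd_deltaAux {k m : ℕ} (h : k + 2 ≤ m) (hm : m ≤ n) :
    LeftDvd (gen n k) (deltaAux n m) := by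
  induction m, h using Nat.le_induction with
  | base =>
    obtain ⟨x, hx⟩ := exists_desc_mul_desc (n := n) (k := k) le_rfl (by omega)
    refine ⟨deltaAux n k * (desc n k * x), ?_⟩
    rw [← mul_assoc (gen n k), (gen_comm_deltaAux le_rfl).eq, mul_assoc, ← mul_assoc (gen n k),
      ← desc_succ, ← hx, ← mul_assoc]
    rfl
  | succ m h ih => exact leftDvd_trans (ih (by omega)) ⟨_, rfl⟩

theorem σ_leftDvd_Δ (i : Fin (n - 1)) : LeftDvd (σ i) (Δ n) := by
  have h := gen_leftDvd_deltaAux (n := n) (k := i) (m := n) (by omega) le_rfl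
  rwa [gen, dif_pos i.isLt] at h

end BraidMonoid

/-- In the positive braid monoid `B_n⁺`, every nontrivial element has a nontrivial head:
the greatest common left-divisor of `g ≠ 1` and `Δ_n` exists and is not `1`. -/
theorem braidMonoid_head_nontrivial (n : ℕ) (hn : 1 ≤ n) (g : BraidMonoid n) (hg : g ≠ 1) :
    ∃ d : BraidMonoid n, IsGCLD g (Δ n) d ∧ d ≠ 1 := by
  obtain ⟨d, hd⟩ := BraidMonoid.exists_isGCLD g (Δ n)
  refine ⟨d, hd, ?_⟩
  rintro rfl
  obtain ⟨i, y, rfl⟩ := (BraidMonoid.eq_one_or_exists_σ_mul g).resolve_left hg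
  obtain ⟨c, hc⟩ := hd.2.2 (σ i) ⟨y, rfl⟩ (BraidMonoid.σ_leftDvd_Δ i)
  have := congrArg BraidMonoid.len hc
  rw [BraidMonoid.len_one, BraidMonoid.len_mul, BraidMonoid.len_σ] at this
  omega
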